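/- arXiv:1907.00803 — 2 statements merged into one kernel-verified Lean document; each statement's English description precedes it below -/
import Mathlib

section
/- Let K be a field, let (A, μ, α, β) be a BiHom-associative algebra over K, and let γ : A → A be a morphism of BiHom-associative algebras from (A, μ, α, β) to itself, i.e. γ(μ(x,y)) = μ(γ(x), γ(y)) for all x, y ∈ A, γ ∘ α = α ∘ γ and γ ∘ β = β ∘ γ. Then (A, γ ∘ μ, γ ∘ α, γ ∘ β) (with multiplication (x,y) ↦ γ(μ(x,y)) and structure maps γ ∘ α and γ ∘ β) is again a BiHom-associative algebra over K. -/
/-- A BiHom-associative algebra structure on a `K`-vector space `A`: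
a bilinear multiplication `μ` together with commuting multiplicative
linear structure maps `α, β` satisfying the BiHom-associativity condition. -/
def IsBiHomAssociative {K : Type*} [Field K] {A : Type*} [AddCommGroup A] [Module K A]
    (μ : A →ₗ[K] A →ₗ[K] A) (α β : A →ₗ[K] A) : Prop :=
  (∀ x, α (β x) = β (α x)) ∧
  (∀ x y, α (μ x y) = μ (α x) (α y)) ∧
  (∀ x y, β (μ x y) = μ (β x) (β y)) ∧
  (∀ x y z, μ (α x) (μ y z) = μ (μ x y) (β z))

/-- If `γ` is a morphism of `(A, μ, α, β)` to itself, then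
`(A, γ ∘ μ, γ ∘ α, γ ∘ β)` is again a BiHom-associative algebra. -/
theorem yau_twist {K : Type*} [Field K] {A : Type*} [AddCommGroup A] [Module K A]
    (μ : A →ₗ[K] A →ₗ[K] A) (α β γ : A →ₗ[K] A)
    (h : IsBiHomAssociative μ α β)
    (hγμ : ∀ x y, γ (μ x y) = μ (γ x) (γ y))
    (hγα : γ ∘ₗ α = α ∘ₗ γ)
    (hγβ : γ ∘ₗ β = β ∘ₗ γ) :
    IsBiHomAssociative (μ.compr₂ γ) (γ ∘ₗ α) (γ ∘ₗ β) := by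
  obtain ⟨hαβ, hα, hβ, hassoc⟩ := h
  have hγα' (x : A) : α (γ x) = γ (α x) := (LinearMap.congr_fun hγα x).symm
  have hγβ' (x : A) : β (γ x) = γ (β x) := (LinearMap.congr_fun hγβ x).symm
  refine ⟨fun x => ?_, fun x y => ?_, fun x y => ?_, fun x y z => ?_⟩ <;>
    simp only [LinearMap.comp_apply, LinearMap.compr₂_apply]
  · rw [hγα', hγβ', hαβ]
  · rw [hγα', hα, hγμ (α x)]
  · rw [hγβ', hβ, hγμ (β x)]
  · rw [← hγμ, ← hγμ, hassoc]
end

section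
/- Let K be a field and let (A, μ, α, β) be a BiHom-associative algebra over K. On the K-vector space Ã = A × K define the bilinear map μ̃((a, λ), (b, κ)) = (μ(a,b) + λ·β(b) + κ·α(a), λκ), the linear maps α̃(a, λ) = (α(a), λ) and β̃(a, λ) = (β(a), λ), and set u = (0, 1). Then (Ã, μ̃, α̃, β̃) is a BiHom-associative algebra over K which is unital with unit u, i.e. α̃(u) = u, β̃(u) = u, μ̃(x, u) = α̃(x) and μ̃(u, x) = β̃(x) for all x ∈ Ã. -/
/-- `(A, μ, α, β)` is unital with unit `u`. -/
def IsBiHomUnit {K : Type*} [Field K] {A : Type*} [AddCommGroup A] [Module K A]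
    (μ : A →ₗ[K] A →ₗ[K] A) (α β : A →ₗ[K] A) (u : A) : Prop :=
  α u = u ∧ β u = u ∧ (∀ x, μ x u = α x) ∧ (∀ x, μ u x = β x)

/-- The multiplication of the unital extension `Ã = A × K`:
`μ̃((a,λ),(b,κ)) = (μ(a,b) + λ•β(b) + κ•α(a), λκ)`. -/
def extMul {K : Type*} [Field K] {A : Type*} [AddCommGroup A] [Module K A]
    (μ : A →ₗ[K] A →ₗ[K] A) (α β : A →ₗ[K] A) :
    (A × K) →ₗ[K] (A × K) →ₗ[K] (A × K) :=
  LinearMap.mk₂ K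
    (fun p q => (μ p.1 q.1 + p.2 • β q.1 + q.2 • α p.1, p.2 * q.2))
    (fun p p' q => by
      refine Prod.ext ?_ ?_
      · simp only [Prod.fst_add, Prod.snd_add, map_add, LinearMap.add_apply]
        module
      · simp only [Prod.snd_add, Prod.fst_add]; ring)
    (fun c p q => by
      refine Prod.ext ?_ ?_
      · simp only [Prod.smul_fst, Prod.smul_snd, map_smul, LinearMap.smul_apply,
          smul_eq_mul, Prod.smul_mk, smul_add]
        module
      · simp only [Prod.smul_fst, Prod.smul_snd, Prod.smul_mk, smul_eq_mul]; ring)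
    (fun p q q' => by
      refine Prod.ext ?_ ?_
      · simp only [Prod.fst_add, Prod.snd_add, map_add, LinearMap.add_apply]
        module
      · simp only [Prod.snd_add, Prod.fst_add]; ring)
    (fun c p q => by
      refine Prod.ext ?_ ?_
      · simp only [Prod.smul_fst, Prod.smul_snd, map_smul, LinearMap.smul_apply,
          smul_eq_mul, Prod.smul_mk, smul_add]
        module
      · simp only [Prod.smul_fst, Prod.smul_snd, Prod.smul_mk, smul_eq_mul]; ring)

/-- Adjoining a unit to a BiHom-associative algebra: `(Ã, μ̃, α̃, β̃)` with
`α̃ = α × id`, `β̃ = β × id` is a BiHom-associative algebra, unital with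
unit `u = (0,1)`. -/
theorem unital_extension {K : Type*} [Field K] {A : Type*} [AddCommGroup A] [Module K A]
    (μ : A →ₗ[K] A →ₗ[K] A) (α β : A →ₗ[K] A)
    (h : IsBiHomAssociative μ α β) :
    IsBiHomAssociative (extMul μ α β)
      (α.prodMap (LinearMap.id : K →ₗ[K] K)) (β.prodMap (LinearMap.id : K →ₗ[K] K)) ∧
    IsBiHomUnit (extMul μ α β)
      (α.prodMap (LinearMap.id : K →ₗ[K] K)) (β.prodMap (LinearMap.id : K →ₗ[K] K))
      ((0 : A), (1 : K)) := by
  obtain ⟨hαβ, hα, hβ, hassoc⟩ := h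
  refine ⟨⟨?_, ?_, ?_, ?_⟩, ?_, ?_, ?_, ?_⟩
  · rintro ⟨a, l⟩
    simp [hαβ]
  · rintro ⟨a, l⟩ ⟨b, k⟩
    simp [extMul, hα, hαβ]
  · rintro ⟨a, l⟩ ⟨b, k⟩
    simp [extMul, hβ, hαβ]
  · rintro ⟨a, l⟩ ⟨b, k⟩ ⟨c, m⟩
    refine Prod.ext ?_ ?_
    · simp only [extMul, LinearMap.mk₂_apply, LinearMap.prodMap_apply, LinearMap.id_apply,
        map_add, map_smul, LinearMap.add_apply, LinearMap.smul_apply, hα, hβ, hαβ, hassoc]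
      module
    · simp [extMul, mul_assoc]
  · simp
  · simp
  · rintro ⟨a, l⟩
    simp [extMul]
  · rintro ⟨a, l⟩
    simp [extMul]
end
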